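/- arXiv:2310.11866 — 2 statements merged into one kernel-verified Lean document; each statement's English description precedes it below -/
import Mathlib

section
/- Let f₁,…,fₙ : ℝ^d → ℝ be differentiable, let f = (1/n)∑_{i=1}^n fᵢ, and fix x ∈ ℝ^d with ‖∇fᵢ(x)‖ ≤ L_f for all i. Fix δ ∈ (0,1) and ε_g > 0. Let i₁,…,i_m be independent indices, each uniformly distributed on {1,…,n}, and set g(x) = (1/m) ∑_{j=1}^m ∇f_{i_j}(x). If m ≥ 16 log(2d/δ) · L_f² / ε_g², then with probability at least 1 − δ one has ‖∇f(x) − g(x)‖ ≤ ε_g. -/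
theorem aux_cons_sum {n m : ℕ} (g : (Fin (m+1) → Fin n) → ℝ) :
    ∑ i, g i = ∑ a : Fin n, ∑ i : Fin m → Fin n, g (Fin.cons a i) := by
  rw [← Fintype.sum_prod_type' (f := fun a i => g (Fin.cons a i))]
  exact (Fintype.sum_equiv (Fin.consEquiv (fun _ : Fin (m+1) => Fin n)) _ _ (fun p => rfl)).symm

theorem aux_sym {n : ℕ} (hn : 0 < n) (l c : ℝ) (y : Fin n → ℝ)
    (h : ∀ a b, y a - y b ≤ c) :
    ∑ a, Real.exp (l * (y a - (∑ b, y b) / n)) ≤ n * Real.exp (l ^ 2 * c ^ 2 / 2) := by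
  have hn' : (0:ℝ) < n := by exact_mod_cast hn
  have h1 : ∀ a, (n:ℝ) * Real.exp (l * (y a - (∑ b, y b) / n))
      ≤ ∑ b, Real.exp (l * (y a - y b)) := by
    intro a
    set z := l * (y a - (∑ b, y b) / n) with hz
    have h2 : ∀ b, Real.exp z * (1 + (l * (y a - y b) - z)) ≤ Real.exp (l * (y a - y b)) := by
      intro b
      have h3 := Real.add_one_le_exp (l * (y a - y b) - z)
      have h4 : Real.exp (l * (y a - y b)) = Real.exp z * Real.exp (l * (y a - y b) - z) := by
        rw [← Real.exp_add]; congr 1; ring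
      rw [h4]
      exact mul_le_mul_of_nonneg_left (by linarith) (Real.exp_pos z).le
    refine le_trans (le_of_eq ?_) (Finset.sum_le_sum (fun b _ => h2 b))
    rw [← Finset.mul_sum, Finset.sum_add_distrib, Finset.sum_sub_distrib, ← Finset.mul_sum,
      Finset.sum_sub_distrib]
    simp only [Finset.sum_const, Finset.card_univ, Fintype.card_fin, nsmul_eq_mul]
    rw [hz]
    field_simp
    ring
  have h5 : ∑ a, ∑ b, Real.exp (l * (y a - y b)) ≤ (n:ℝ) * n * Real.exp (l ^ 2 * c ^ 2 / 2) := by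
    have h6 : ∑ a, ∑ b, Real.exp (l * (y a - y b)) = ∑ a, ∑ b, Real.cosh (l * (y a - y b)) := by
      have h7 : ∑ a, ∑ b, Real.exp (l * (y a - y b)) = ∑ a, ∑ b, Real.exp (-(l * (y a - y b))) := by
        rw [Finset.sum_comm]
        refine Finset.sum_congr rfl fun a _ => Finset.sum_congr rfl fun b _ => ?_
        congr 1; ring
      simp only [Real.cosh_eq, ← Finset.sum_div, Finset.sum_add_distrib]
      rw [← h7]; ring
    rw [h6]
    have h8 : ∀ a b, Real.cosh (l * (y a - y b)) ≤ Real.exp (l ^ 2 * c ^ 2 / 2) := by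
      intro a b
      refine (Real.cosh_le_exp_half_sq _).trans (Real.exp_le_exp.2 ?_)
      have : (y a - y b)^2 ≤ c^2 := sq_le_sq' (by linarith [h b a]) (h a b)
      nlinarith [mul_le_mul_of_nonneg_left this (sq_nonneg l)]
    refine (Finset.sum_le_sum fun a _ => Finset.sum_le_sum fun b _ => h8 a b).trans (le_of_eq ?_)
    simp; ring
  have h9 := (Finset.sum_le_sum (fun a (_ : a ∈ Finset.univ) => h1 a)).trans h5
  rw [← Finset.mul_sum, mul_assoc] at h9
  exact le_of_mul_le_mul_left h9 hn'

theorem aux_mc {n : ℕ} (hn : 0 < n) (l c : ℝ) : ∀ (m : ℕ) (F : (Fin m → Fin n) → ℝ),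
    (∀ i i' k, (∀ j, j ≠ k → i j = i' j) → F i - F i' ≤ c) →
    ∑ i, Real.exp (l * (F i - (∑ j, F j) / n ^ m)) ≤ n ^ m * Real.exp (m * (l ^ 2 * c ^ 2 / 2)) := by
  have hn' : (0:ℝ) < n := by exact_mod_cast hn
  intro m
  induction m with
  | zero => intro F _; simp
  | succ m ih =>
    intro F hF
    set G : Fin n → ℝ := fun a => (∑ i : Fin m → Fin n, F (Fin.cons a i)) / n ^ m with hG
    have hmean : (∑ j, F j) / (n:ℝ) ^ (m+1) = (∑ b, G b) / n := by
      rw [aux_cons_sum, hG, ← Finset.sum_div, pow_succ, div_div]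
    have hGc : ∀ a b, G a - G b ≤ c := by
      intro a b
      rw [hG]; dsimp only
      rw [← sub_div, div_le_iff₀ (by positivity), ← Finset.sum_sub_distrib]
      have : ∀ i : Fin m → Fin n, F (Fin.cons a i) - F (Fin.cons b i) ≤ c := by
        intro i
        apply hF _ _ 0
        intro j hj
        obtain ⟨k, rfl⟩ := Fin.exists_succ_eq.2 hj
        simp
      refine (Finset.sum_le_sum fun i _ => this i).trans (le_of_eq ?_)
      simp; ring
    have hin : ∀ a, ∑ i : Fin m → Fin n, Real.exp (l * (F (Fin.cons a i) - G a))
        ≤ n ^ m * Real.exp (m * (l ^ 2 * c ^ 2 / 2)) := by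
      intro a
      apply ih (fun i => F (Fin.cons a i))
      intro i i' k h
      apply hF _ _ k.succ
      intro j hj
      refine Fin.cases (by simp) (fun j hj => ?_) j hj
      simpa using h j (fun e => hj (by rw [e]))
    rw [aux_cons_sum, hmean]
    have hs := aux_sym hn l c G hGc
    calc _ = ∑ a, Real.exp (l * (G a - (∑ b, G b) / n)) *
          ∑ i : Fin m → Fin n, Real.exp (l * (F (Fin.cons a i) - G a)) := by
          refine Finset.sum_congr rfl fun a _ => ?_
          rw [Finset.mul_sum]
          refine Finset.sum_congr rfl fun i _ => ?_
          rw [← Real.exp_add]; congr 1; ring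
      _ ≤ ∑ a, Real.exp (l * (G a - (∑ b, G b) / n)) *
          (n ^ m * Real.exp (m * (l ^ 2 * c ^ 2 / 2))) :=
          Finset.sum_le_sum fun a _ => mul_le_mul_of_nonneg_left (hin a) (Real.exp_pos _).le
      _ ≤ (n * Real.exp (l ^ 2 * c ^ 2 / 2)) * (n ^ m * Real.exp (m * (l ^ 2 * c ^ 2 / 2))) := by
          rw [← Finset.sum_mul]
          exact mul_le_mul_of_nonneg_right hs (by positivity)
      _ = _ := by
          push_cast
          rw [add_mul (m:ℝ) 1, one_mul, Real.exp_add]; ring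

theorem aux_var {E : Type*} [NormedAddCommGroup E] [InnerProductSpace ℝ E] {n : ℕ}
    (w : Fin n → E) (hw : ∑ a, w a = 0) (L : ℝ) (hL : ∑ a, ‖w a‖ ^ 2 ≤ n * L ^ 2) :
    ∀ m : ℕ, ∑ i : Fin m → Fin n, ‖∑ j, w (i j)‖ ^ 2 ≤ n ^ m * (m * L ^ 2) := by
  intro m
  induction m with
  | zero => simp
  | succ m ih =>
    rw [aux_cons_sum, Finset.sum_comm]
    have h : ∀ i : Fin m → Fin n, ∑ a, ‖∑ j, w ((Fin.cons a i : Fin (m+1) → Fin n) j)‖ ^ 2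
        = ∑ a, ‖w a‖ ^ 2 + n * ‖∑ j, w (i j)‖ ^ 2 := by
      intro i
      simp only [Fin.sum_univ_succ, Fin.cons_zero, Fin.cons_succ, norm_add_sq_real,
        Finset.sum_add_distrib, ← Finset.mul_sum]
      rw [← sum_inner, hw]
      simp
    simp only [h]
    rw [Finset.sum_add_distrib, ← Finset.mul_sum]
    simp only [Finset.sum_const, Finset.card_univ, Fintype.card_fun, Fintype.card_fin, nsmul_eq_mul]
    push_cast
    have h1 := mul_le_mul_of_nonneg_left hL (show (0:ℝ) ≤ n ^ m by positivity)
    have h2 := mul_le_mul_of_nonneg_left ih (show (0:ℝ) ≤ n by positivity)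
    calc _ ≤ _ := add_le_add h1 h2
      _ = _ := by ring

theorem aux_main {E : Type*} [NormedAddCommGroup E] [InnerProductSpace ℝ E] {n : ℕ} (hn : 0 < n)
    (v : Fin n → E) (L : ℝ) (hL : 0 < L) (hv : ∀ i, ‖v i‖ ≤ L) (m : ℕ)
    (ε δ s : ℝ) (hε : 0 < ε) (hδ : 0 < δ) (hs : 1 / 4 ≤ s)
    (hsδ : Real.exp (- (2 * (s - 1 / 4) ^ 2)) ≤ δ)
    (hm : 16 * s ^ 2 * L ^ 2 ≤ m * ε ^ 2) :
    (Nat.card {i : Fin m → Fin n // ¬ ‖(n:ℝ)⁻¹ • ∑ a, v a - (m : ℝ)⁻¹ • ∑ j, v (i j)‖ ≤ ε} : ℝ)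
      ≤ δ * n ^ m := by
  classical
  have hn' : (0:ℝ) < n := by exact_mod_cast hn
  have hm0 : (0:ℝ) < m := by
    by_contra h
    have : (0:ℝ) < 16 * s^2 * L^2 := by positivity
    nlinarith [sq_nonneg ε]
  set μ := (n:ℝ)⁻¹ • ∑ a, v a with hμ
  have hnμ : (n:ℝ) • μ = ∑ a, v a := by
    rw [hμ, smul_smul, mul_inv_cancel₀ hn'.ne', one_smul]
  set w : Fin n → E := fun a => v a - μ with hw
  have hw0 : ∑ a, w a = 0 := by
    rw [hw, Finset.sum_sub_distrib, ← hnμ]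
    simp [Nat.cast_smul_eq_nsmul]
  have hw2 : ∑ a, ‖w a‖ ^ 2 ≤ n * L ^ 2 := by
    have h1 : ∑ a, ‖v a‖ ^ 2 = ∑ a, ‖w a‖ ^ 2 + n * ‖μ‖ ^ 2 := by
      have : ∀ a, v a = w a + μ := fun a => by simp [hw]
      simp only [this, norm_add_sq_real, Finset.sum_add_distrib, ← Finset.mul_sum]
      rw [← sum_inner, hw0]; simp
    have h2 : ∑ a, ‖v a‖ ^ 2 ≤ n * L ^ 2 := by
      refine (Finset.sum_le_sum fun a _ => pow_le_pow_left₀ (norm_nonneg _) (hv a) 2).trans ?_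
      simp
    nlinarith [sq_nonneg ‖μ‖]
  set F : (Fin m → Fin n) → ℝ := fun i => ‖∑ j, w (i j)‖ with hF
  have hbd : ∀ i i' k, (∀ j, j ≠ k → i j = i' j) → F i - F i' ≤ 2 * L := by
    intro i i' k h
    refine (norm_sub_norm_le _ _).trans ?_
    rw [← Finset.sum_sub_distrib, Finset.sum_eq_single k (fun j _ hj => by rw [h j hj, sub_self])
      (by simp)]
    simp only [hw, sub_sub_sub_cancel_right]
    refine (norm_sub_le _ _).trans ?_
    linarith [hv (i k), hv (i' k)]
  set M := (∑ j, F j) / (n:ℝ) ^ m with hM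
  have hN : (0:ℝ) < n ^ m := by positivity
  have hMle : M ≤ Real.sqrt m * L := by
    have h1 := aux_var w hw0 L hw2 m
    have h2 : (∑ j, F j) ^ 2 ≤ (n:ℝ)^m * ∑ j, F j ^ 2 := by
      have := sq_sum_le_card_mul_sum_sq (s := (Finset.univ : Finset (Fin m → Fin n))) (f := F)
      simpa using this
    have h3 : (∑ j, F j) ^ 2 ≤ ((n:ℝ)^m * (Real.sqrt m * L)) ^ 2 := by
      refine h2.trans ((mul_le_mul_of_nonneg_left h1 hN.le).trans (le_of_eq ?_))
      rw [mul_pow, mul_pow, Real.sq_sqrt hm0.le]; ring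
    rw [hM, div_le_iff₀ hN, mul_comm]
    exact le_of_sq_le_sq h3 (by positivity)
  set r := Real.sqrt m with hr
  have hr0 : 0 < r := Real.sqrt_pos.2 hm0
  have hrm : (m:ℝ) = r ^ 2 := (Real.sq_sqrt hm0.le).symm
  have hrε : 4 * s * L ≤ r * ε := by
    refine le_of_sq_le_sq ?_ (by positivity)
    rw [mul_pow r, ← hrm]; linarith
  set l := (r * ε - L) / (4 * L ^ 2 * r) with hl
  have hl0 : 0 ≤ l := by
    apply div_nonneg _ (by positivity)
    nlinarith
  have hmc := aux_mc hn l (2 * L) m F hbd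
  rw [← hM] at hmc
  have hbad : ∀ i : Fin m → Fin n, ¬ ‖μ - (m : ℝ)⁻¹ • ∑ j, v (i j)‖ ≤ ε → r ^ 2 * ε ≤ F i := by
    intro i hi
    push Not at hi
    have : μ - (m : ℝ)⁻¹ • ∑ j, v (i j) = -((m:ℝ)⁻¹ • ∑ j, w (i j)) := by
      simp only [hw, Finset.sum_sub_distrib, Finset.sum_const, Finset.card_univ, Fintype.card_fin,
        smul_sub, ← Nat.cast_smul_eq_nsmul ℝ, smul_smul, inv_mul_cancel₀ hm0.ne', one_smul]
      abel
    rw [this, norm_neg, norm_smul, norm_inv, Real.norm_of_nonneg hm0.le, inv_mul_eq_div,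
      lt_div_iff₀ hm0] at hi
    rw [← hrm]; simp only [hF]; linarith
  rw [Nat.card_eq_fintype_card, Fintype.card_subtype]
  set B := Finset.univ.filter fun i : Fin m → Fin n => ¬ ‖μ - (m : ℝ)⁻¹ • ∑ j, v (i j)‖ ≤ ε with hB
  have h1 : (B.card : ℝ) * Real.exp (l * (r ^ 2 * ε - r * L))
      ≤ n ^ m * Real.exp (m * (l ^ 2 * (2 * L) ^ 2 / 2)) := by
    refine le_trans ?_ hmc
    refine le_trans ?_ (Finset.sum_le_sum_of_subset_of_nonneg (Finset.subset_univ B)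
      (fun _ _ _ => (Real.exp_pos _).le))
    rw [← nsmul_eq_mul]
    apply Finset.card_nsmul_le_sum
    intro i hi
    have := hbad i (Finset.mem_filter.1 hi).2
    exact Real.exp_le_exp.2 (mul_le_mul_of_nonneg_left (by linarith) hl0)
  have h2 : (B.card : ℝ) ≤ n ^ m * Real.exp (m * (l ^ 2 * (2 * L) ^ 2 / 2) - l * (r ^ 2 * ε - r * L)) := by
    rw [Real.exp_sub, ← mul_div_assoc, le_div_iff₀ (Real.exp_pos _)]
    exact h1
  refine h2.trans ?_
  rw [mul_comm δ]
  refine mul_le_mul_of_nonneg_left (le_trans (Real.exp_le_exp.2 ?_) hsδ) hN.le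
  have h3 : (m:ℝ) * (l ^ 2 * (2 * L) ^ 2 / 2) - l * (r ^ 2 * ε - r * L)
      = - ((r * ε / L - 1) ^ 2 / 8) := by
    rw [hl, hrm]; field_simp; ring
  rw [h3]
  have h4 : 4 * s ≤ r * ε / L := by rw [le_div_iff₀ hL]; exact hrε
  nlinarith [mul_self_le_mul_self (show 0 ≤ 4 * s - 1 by linarith) (show 4 * s - 1 ≤ r * ε / L - 1 by linarith)]

/-- subsampled gradient concentration.  The probability over the i.i.d.
uniform choice of the indices `i : Fin m → Fin n` is expressed by counting:
`P(event) = Nat.card {i // event i} / n^m`. -/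
theorem stmt_14 {d n : ℕ} (hd : 0 < d) (hn : 0 < n)
    (f : Fin n → EuclideanSpace ℝ (Fin d) → ℝ)
    (hdiff : ∀ i, Differentiable ℝ (f i))
    (x : EuclideanSpace ℝ (Fin d)) (Lf : ℝ)
    (hLf : ∀ i, ‖gradient (f i) x‖ ≤ Lf)
    (δ εg : ℝ) (hδ0 : 0 < δ) (hδ1 : δ < 1) (hεg : 0 < εg)
    (m : ℕ)
    (hm : 16 * Real.log (2 * d / δ) * Lf ^ 2 / εg ^ 2 ≤ (m : ℝ)) :
    1 - δ ≤ (Nat.card {i : Fin m → Fin n //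
        ‖gradient (fun y => (1 / n : ℝ) * ∑ j, f j y) x
            - (m : ℝ)⁻¹ • ∑ j, gradient (f (i j)) x‖ ≤ εg} : ℝ) / (n ^ m : ℝ) := by
  classical
  have hn' : (0:ℝ) < n := by exact_mod_cast hn
  have hgrad : gradient (fun y => (1 / n : ℝ) * ∑ j, f j y) x
      = (n:ℝ)⁻¹ • ∑ a, gradient (f a) x := by
    have h1 : HasFDerivAt (fun y => (1 / n : ℝ) * ∑ j, f j y)
        ((1 / n : ℝ) • ∑ j, fderiv ℝ (f j) x) x :=
      (HasFDerivAt.fun_sum fun j _ => (hdiff j x).hasFDerivAt).const_mul _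
    unfold gradient
    rw [h1.fderiv]
    simp [map_sum]
  rw [hgrad]
  set v : Fin n → EuclideanSpace ℝ (Fin d) := fun a => gradient (f a) x with hvdef
  have hL0 : 0 ≤ Lf := (norm_nonneg _).trans (hLf ⟨0, hn⟩)
  have key : (Nat.card {i : Fin m → Fin n // ¬ ‖(n:ℝ)⁻¹ • ∑ a, v a - (m : ℝ)⁻¹ • ∑ j, v (i j)‖ ≤ εg} : ℝ)
      ≤ δ * n ^ m := by
    rcases hL0.eq_or_lt with h0 | hL
    · have hv0 : ∀ a, v a = 0 := fun a => norm_le_zero_iff.1 (by rw [h0]; exact hLf a)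
      simp only [hv0]
      simp [hεg.le]
      positivity
    · set K := Real.log (2 * d / δ) with hK
      have hd1 : (1:ℝ) ≤ d := by exact_mod_cast hd
      have hKge : Real.log 2 - Real.log δ ≤ K := by
        rw [← Real.log_div two_ne_zero hδ0.ne']
        apply Real.log_le_log (by positivity)
        gcongr; linarith
      have hlog2 := Real.log_two_gt_d9
      have hlogδ := Real.log_neg hδ0 hδ1
      have hK0 : 0 ≤ K := by linarith
      have hsq := Real.sq_sqrt hK0
      refine aux_main hn v Lf hL hLf m εg δ (Real.sqrt K) hεg hδ0 ?_ ?_ ?_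
      · apply Real.le_sqrt_of_sq_le; linarith
      · rw [← Real.le_log_iff_exp_le hδ0]
        nlinarith [sq_nonneg (Real.sqrt K - 1/2)]
      · rw [hsq]
        exact (div_le_iff₀ (by positivity)).1 hm
  have hcard : (Nat.card {i : Fin m → Fin n // ‖(n:ℝ)⁻¹ • ∑ a, v a - (m : ℝ)⁻¹ • ∑ j, v (i j)‖ ≤ εg} : ℝ)
     + (Nat.card {i : Fin m → Fin n // ¬ ‖(n:ℝ)⁻¹ • ∑ a, v a - (m : ℝ)⁻¹ • ∑ j, v (i j)‖ ≤ εg} : ℝ) = n ^ m := by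
    rw [Nat.card_eq_fintype_card, Nat.card_eq_fintype_card, Fintype.card_subtype,
      Fintype.card_subtype, ← Nat.cast_add, Finset.card_filter_add_card_filter_not]
    simp
  rw [le_div_iff₀ (by positivity)]
  linarith
end

section
/- Let f₁,…,fₙ : ℝ^d → ℝ be twice differentiable, let f = (1/n)∑_{i=1}^n fᵢ, and fix x ∈ ℝ^d with ‖∇²fᵢ(x)‖ ≤ L_B (spectral norm) for all i. Fix δ ∈ (0,1), ε_B > 0 and v₀ ∈ (0,1]. Let i₁,…,i_m be independent indices, each uniformly distributed on {1,…,n}, and set B(x) = (1/m) ∑_{j=1}^m ∇²f_{i_j}(x). If m ≥ 16 log(2d/δ) · L_B² / (v₀² ε_B²), then with probability at least 1 − δ one has ‖∇²f(x) − B(x)‖ ≤ v₀ ε_B. -/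
lemma aux_exp (x y : ℝ) : Real.exp x - Real.exp y ≤ (x - y) * Real.exp x := by
  have h := Real.add_one_le_exp (y - x)
  have h2 : Real.exp y = Real.exp (y - x) * Real.exp x := by rw [← Real.exp_add]; ring_nf
  rw [h2]
  nlinarith [Real.exp_pos x]

lemma aux_sinh (x y : ℝ) (h : y ≤ x) :
    Real.sinh x - Real.sinh y ≤ (x - y) * (Real.cosh x + Real.cosh y) := by
  have h1 := aux_exp x y
  have h2 := aux_exp (-y) (-x)
  rw [Real.sinh_eq, Real.sinh_eq, Real.cosh_eq, Real.cosh_eq]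
  nlinarith [mul_nonneg (sub_nonneg.2 h) (Real.exp_pos (-x)).le,
    mul_nonneg (sub_nonneg.2 h) (Real.exp_pos y).le]

lemma aux_scalar (θ a b : ℝ) (hθ : 0 ≤ θ) :
    (a - b) * (Real.sinh (θ * a) - Real.sinh (θ * b)) ≤
      θ * (a - b) ^ 2 * (Real.cosh (θ * a) + Real.cosh (θ * b)) := by
  rcases le_total b a with h | h
  · have := mul_le_mul_of_nonneg_left
      (aux_sinh (θ * a) (θ * b) (mul_le_mul_of_nonneg_left h hθ)) (sub_nonneg.2 h)
    linarith
  · have := mul_le_mul_of_nonneg_left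
      (aux_sinh (θ * b) (θ * a) (mul_le_mul_of_nonneg_left h hθ)) (sub_nonneg.2 h)
    linarith

open scoped InnerProductSpace in
lemma aux_key {d : ℕ} (A B : EuclideanSpace ℝ (Fin d) →L[ℝ] EuclideanSpace ℝ (Fin d))
    (u v : OrthonormalBasis (Fin d) ℝ (EuclideanSpace ℝ (Fin d))) (a b : Fin d → ℝ)
    (hA : (A : EuclideanSpace ℝ (Fin d) →ₗ[ℝ] EuclideanSpace ℝ (Fin d)).IsSymmetric)
    (hB : (B : EuclideanSpace ℝ (Fin d) →ₗ[ℝ] EuclideanSpace ℝ (Fin d)).IsSymmetric)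
    (hu : ∀ k, A (u k) = a k • u k) (hv : ∀ k, B (v k) = b k • v k)
    (θ : ℝ) (hθ : 0 ≤ θ) (K : ℝ) (hK : ‖A - B‖ ≤ K) :
    ∑ k, Real.sinh (θ * a k) * ⟪u k, (A - B) (u k)⟫_ℝ
      - ∑ k, Real.sinh (θ * b k) * ⟪v k, (A - B) (v k)⟫_ℝ
      ≤ θ * K ^ 2 * (∑ k, Real.cosh (θ * a k) + ∑ k, Real.cosh (θ * b k)) := by
  have hcross : ∀ k l, ⟪v l, (A - B) (u k)⟫_ℝ = (a k - b l) * ⟪v l, u k⟫_ℝ := by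
    intro k l
    have : ⟪v l, B (u k)⟫_ℝ = b l * ⟪v l, u k⟫_ℝ := by
      have := hB (v l) (u k)
      simp only [ContinuousLinearMap.coe_coe] at this
      rw [← this, hv, real_inner_smul_left]
    rw [sub_apply, inner_sub_right, this, hu, real_inner_smul_right]
    ring
  have hcross' : ∀ k l, ⟪(A - B) (v l), u k⟫_ℝ = (a k - b l) * ⟪v l, u k⟫_ℝ := by
    intro k l
    rw [← hcross]
    have h1 := hA (v l) (u k)
    have h2 := hB (v l) (u k)
    simp only [ContinuousLinearMap.coe_coe] at h1 h2
    rw [sub_apply, sub_apply, inner_sub_right,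
      inner_sub_left, h1, h2]
  have e1 : ∀ k, ⟪u k, (A - B) (u k)⟫_ℝ = ∑ l, (a k - b l) * ⟪v l, u k⟫_ℝ ^ 2 := by
    intro k
    rw [← v.sum_inner_mul_inner (u k)]
    refine Finset.sum_congr rfl fun l _ => ?_
    rw [hcross, real_inner_comm]; ring
  have e2 : ∀ l, ⟪v l, (A - B) (v l)⟫_ℝ = ∑ k, (a k - b l) * ⟪v l, u k⟫_ℝ ^ 2 := by
    intro l
    rw [← u.sum_inner_mul_inner (v l)]
    refine Finset.sum_congr rfl fun k _ => ?_
    have h1 : ⟪u k, (A - B) (v l)⟫_ℝ = ⟪(A - B) (v l), u k⟫_ℝ := real_inner_comm _ _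
    rw [h1, hcross']; ring
  have n1 : ∀ k, ∑ l, (a k - b l) ^ 2 * ⟪v l, u k⟫_ℝ ^ 2 ≤ K ^ 2 := by
    intro k
    have h1 : ∑ l, (a k - b l) ^ 2 * ⟪v l, u k⟫_ℝ ^ 2 = ‖(A - B) (u k)‖ ^ 2 := by
      rw [← v.sum_sq_norm_inner_right ((A - B) (u k))]
      refine Finset.sum_congr rfl fun l _ => ?_
      rw [hcross, Real.norm_eq_abs, sq_abs]; ring
    rw [h1]
    have := (A - B).le_of_opNorm_le hK (u k)
    rw [u.norm_eq_one, mul_one] at this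
    gcongr
  have n2 : ∀ l, ∑ k, (a k - b l) ^ 2 * ⟪v l, u k⟫_ℝ ^ 2 ≤ K ^ 2 := by
    intro l
    have h1 : ∑ k, (a k - b l) ^ 2 * ⟪v l, u k⟫_ℝ ^ 2 = ‖(A - B) (v l)‖ ^ 2 := by
      rw [← u.sum_sq_norm_inner_right ((A - B) (v l))]
      refine Finset.sum_congr rfl fun k _ => ?_
      have h1 : ⟪u k, (A - B) (v l)⟫_ℝ = ⟪(A - B) (v l), u k⟫_ℝ := real_inner_comm _ _
      rw [h1, hcross', Real.norm_eq_abs, sq_abs]; ring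
    rw [h1]
    have := (A - B).le_of_opNorm_le hK (v l)
    rw [v.norm_eq_one, mul_one] at this
    gcongr
  calc _ = ∑ k, ∑ l, (a k - b l) * (Real.sinh (θ * a k) - Real.sinh (θ * b l))
              * ⟪v l, u k⟫_ℝ ^ 2 := by
        simp_rw [e1, e2, Finset.mul_sum]
        rw [Finset.sum_comm (f := fun l k => Real.sinh (θ * b l) * ((a k - b l) * ⟪v l, u k⟫_ℝ ^ 2)),
          ← Finset.sum_sub_distrib]
        refine Finset.sum_congr rfl fun k _ => ?_
        rw [← Finset.sum_sub_distrib]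
        refine Finset.sum_congr rfl fun l _ => ?_
        ring
    _ ≤ ∑ k, ∑ l, θ * (a k - b l) ^ 2 * (Real.cosh (θ * a k) + Real.cosh (θ * b l))
              * ⟪v l, u k⟫_ℝ ^ 2 := by
        refine Finset.sum_le_sum fun k _ => Finset.sum_le_sum fun l _ => ?_
        exact mul_le_mul_of_nonneg_right (aux_scalar θ _ _ hθ) (sq_nonneg _)
    _ = θ * (∑ k, Real.cosh (θ * a k) * ∑ l, (a k - b l) ^ 2 * ⟪v l, u k⟫_ℝ ^ 2
          + ∑ l, Real.cosh (θ * b l) * ∑ k, (a k - b l) ^ 2 * ⟪v l, u k⟫_ℝ ^ 2) := by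
        simp_rw [Finset.mul_sum]
        rw [Finset.sum_comm (f := fun l k =>
          Real.cosh (θ * b l) * ((a k - b l) ^ 2 * ⟪v l, u k⟫_ℝ ^ 2)),
          ← Finset.sum_add_distrib, Finset.mul_sum]
        refine Finset.sum_congr rfl fun k _ => ?_
        rw [← Finset.sum_add_distrib, Finset.mul_sum]
        refine Finset.sum_congr rfl fun l _ => ?_
        ring
    _ ≤ θ * (∑ k, Real.cosh (θ * a k) * K ^ 2 + ∑ l, Real.cosh (θ * b l) * K ^ 2) := by
        refine mul_le_mul_of_nonneg_left (add_le_add (Finset.sum_le_sum fun k _ => ?_)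
          (Finset.sum_le_sum fun l _ => ?_)) hθ
        · exact mul_le_mul_of_nonneg_left (n1 k) (Real.cosh_pos _).le
        · exact mul_le_mul_of_nonneg_left (n2 l) (Real.cosh_pos _).le
    _ = _ := by rw [← Finset.sum_mul, ← Finset.sum_mul]; ring

lemma aux_diag {d : ℕ} (A : EuclideanSpace ℝ (Fin d) →L[ℝ] EuclideanSpace ℝ (Fin d))
    (hA : (A : EuclideanSpace ℝ (Fin d) →ₗ[ℝ] EuclideanSpace ℝ (Fin d)).IsSymmetric) :
    ∃ (u : OrthonormalBasis (Fin d) ℝ (EuclideanSpace ℝ (Fin d))) (a : Fin d → ℝ),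
      ∀ k, A (u k) = a k • u k := by
  have hd : Module.finrank ℝ (EuclideanSpace ℝ (Fin d)) = d := by simp
  exact ⟨hA.eigenvectorBasis hd, hA.eigenvalues hd, fun k => hA.apply_eigenvectorBasis hd k⟩

lemma aux_norm {d : ℕ} (A : EuclideanSpace ℝ (Fin d) →L[ℝ] EuclideanSpace ℝ (Fin d))
    (u : OrthonormalBasis (Fin d) ℝ (EuclideanSpace ℝ (Fin d))) (a : Fin d → ℝ)
    (hu : ∀ k, A (u k) = a k • u k) (r : ℝ) (hr : 0 ≤ r) (h : ∀ k, |a k| ≤ r) : ‖A‖ ≤ r := by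
  refine A.opNorm_le_bound hr fun x => ?_
  have hx : A x = ∑ k, (a k * u.repr x k) • u k := by
    conv_lhs => rw [← u.sum_repr x]
    rw [map_sum]
    refine Finset.sum_congr rfl fun k _ => ?_
    rw [map_smul, hu, smul_smul, mul_comm]
  have hc : ∀ k, inner ℝ (u k) (A x) = a k * u.repr x k := by
    intro k
    rw [hx, u.orthonormal.inner_right_fintype]
  refine le_of_sq_le_sq ?_ (by positivity) |> fun h => h
  rw [← u.sum_sq_norm_inner_right (A x), mul_pow, ← u.sum_sq_norm_inner_right x, Finset.mul_sum]
  refine Finset.sum_le_sum fun k _ => ?_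
  rw [hc, u.repr_apply_apply, norm_mul, mul_pow]
  gcongr
  exact h k

open scoped InnerProductSpace in
lemma aux_conc {d n m : ℕ} (hn : 0 < n)
    (Y : Fin n → EuclideanSpace ℝ (Fin d) →L[ℝ] EuclideanSpace ℝ (Fin d))
    (hY : ∀ k, (Y k : EuclideanSpace ℝ (Fin d) →ₗ[ℝ] EuclideanSpace ℝ (Fin d)).IsSymmetric)
    (hsum : ∑ k, Y k = 0) (K : ℝ) (hK : ∀ k l, ‖Y k - Y l‖ ≤ K)
    (θ : ℝ) (hθ : 0 ≤ θ) (r : ℝ) (hr : 0 ≤ r) :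
    (Nat.card {i : Fin m → Fin n // ¬ ‖∑ j, Y (i j)‖ ≤ r} : ℝ) * Real.cosh (θ * r) ≤
      (n ^ m : ℝ) * d * Real.exp (m * K ^ 2 * θ ^ 2 / 2) := by
  set S : (Fin m → Fin n) → EuclideanSpace ℝ (Fin d) →L[ℝ] EuclideanSpace ℝ (Fin d) :=
    fun i => ∑ j, Y (i j) with hS
  have hSs : ∀ i, (S i : EuclideanSpace ℝ (Fin d) →ₗ[ℝ] EuclideanSpace ℝ (Fin d)).IsSymmetric := by
    intro i x y
    simp only [hS, ContinuousLinearMap.coe_coe, sum_apply, sum_inner, inner_sum]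
    exact Finset.sum_congr rfl fun j _ => hY (i j) x y
  choose u a hu using fun i => aux_diag (S i) (hSs i)
  set φ : ℝ → ℝ := fun t => ∑ i, ∑ k, Real.cosh (t * a i k) with hφ
  let G : ℝ → (Fin m → Fin n) → (EuclideanSpace ℝ (Fin d) →L[ℝ] EuclideanSpace ℝ (Fin d)) → ℝ :=
    fun t i T => ∑ k, Real.sinh (t * a i k) * ⟪u i k, T (u i k)⟫_ℝ
  have Gsub : ∀ t i T T', G t i (T - T') = G t i T - G t i T' := by
    intro t i T T'
    simp only [G, sub_apply, inner_sub_right, mul_sub, Finset.sum_sub_distrib]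
  have Gsum : ∀ {ι : Type} (s : Finset ι) t i (T : ι → _), G t i (∑ j ∈ s, T j) = ∑ j ∈ s, G t i (T j) := by
    intro ι s t i T
    simp only [G, sum_apply, inner_sum, Finset.mul_sum]
    rw [Finset.sum_comm]
  have hder : ∀ t, HasDerivAt φ (∑ i, G t i (S i)) t := by
    intro t
    refine HasDerivAt.fun_sum fun i _ => HasDerivAt.fun_sum fun k _ => ?_
    have h1 := ((hasDerivAt_id t).mul_const (a i k)).cosh
    have h2 : Real.sinh (t * a i k) * ⟪u i k, S i (u i k)⟫_ℝ =
        Real.sinh (id t * a i k) * (1 * a i k) := by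
      rw [hu, real_inner_smul_right, real_inner_self_eq_norm_sq, (u i).norm_eq_one]
      simp
    rw [h2]
    exact h1
  have hnR : (0 : ℝ) < n := by exact_mod_cast hn
  have hj : ∀ t, 0 ≤ t → ∀ j : Fin m, ∑ i, G t i (Y (i j)) ≤ t * K ^ 2 * φ t := by
    intro t ht j
    have s1 : (n : ℝ) * ∑ i, G t i (Y (i j)) =
        ∑ p : (Fin m → Fin n) × Fin n, G t p.1 (Y (p.1 j) - Y p.2) := by
      rw [Fintype.sum_prod_type, Finset.mul_sum]
      refine Finset.sum_congr rfl fun i _ => ?_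
      simp only [Gsub, Finset.sum_sub_distrib]
      rw [← Gsum Finset.univ t i Y, hsum]
      simp [G]
    let σ : (Fin m → Fin n) × Fin n → (Fin m → Fin n) × Fin n :=
      fun p => (Function.update p.1 j p.2, p.1 j)
    have hσ : Function.Involutive σ := by
      intro p
      simp [σ]
    have s2 : ∀ F : (Fin m → Fin n) × Fin n → ℝ, ∑ p, F (σ p) = ∑ p, F p :=
      fun F => Equiv.sum_comp hσ.toPerm F
    have s3 : ∑ p : (Fin m → Fin n) × Fin n, G t p.1 (Y (p.1 j) - Y p.2) =
        ∑ p : (Fin m → Fin n) × Fin n, - G t (σ p).1 (Y (p.1 j) - Y p.2) := by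
      rw [← s2]
      refine Finset.sum_congr rfl fun p _ => ?_
      simp only [σ, Function.update_self, Gsub]
      ring
    have s4 : ∀ p : (Fin m → Fin n) × Fin n,
        G t p.1 (Y (p.1 j) - Y p.2) - G t (σ p).1 (Y (p.1 j) - Y p.2) ≤
        t * K ^ 2 * (∑ k, Real.cosh (t * a p.1 k) + ∑ k, Real.cosh (t * a (σ p).1 k)) := by
      intro p
      have hD : S p.1 - S (σ p).1 = Y (p.1 j) - Y p.2 := by
        simp only [hS, σ]
        rw [← Finset.sum_sub_distrib, Finset.sum_eq_single j]
        · simp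
        · intro l _ hl
          simp [Function.update_of_ne hl]
        · simp
      rw [← hD]
      exact aux_key _ _ (u p.1) (u (σ p).1) _ _ (hSs _) (hSs _) (hu _) (hu _) t ht K
        (by rw [hD]; exact hK _ _)
    have s5 : ∑ p : (Fin m → Fin n) × Fin n, ∑ k, Real.cosh (t * a p.1 k) = n * φ t := by
      rw [Fintype.sum_prod_type, hφ, Finset.mul_sum]
      simp
    have s6 := Finset.sum_le_sum fun p (_ : p ∈ Finset.univ) => s4 p
    rw [← Finset.mul_sum, Finset.sum_add_distrib, s2 (fun p => ∑ k, Real.cosh (t * a p.1 k)), s5,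
      Finset.sum_sub_distrib, sub_eq_add_neg, ← Finset.sum_neg_distrib, ← s3, ← s1] at s6
    have : (n : ℝ) * ∑ i, G t i (Y (i j)) ≤ n * (t * K ^ 2 * φ t) := by linarith
    exact le_of_mul_le_mul_left this hnR
  have hder_le : ∀ t, 0 ≤ t → ∑ i, G t i (S i) ≤ m * K ^ 2 * t * φ t := by
    intro t ht
    have : ∑ i, G t i (S i) = ∑ j, ∑ i, G t i (Y (i j)) := by
      rw [Finset.sum_comm (f := fun j i => G t i (Y (i j)))]
      exact Finset.sum_congr rfl fun i _ => Gsum Finset.univ t i (fun j => Y (i j))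
    rw [this]
    calc _ ≤ ∑ j : Fin m, t * K ^ 2 * φ t := Finset.sum_le_sum fun j _ => hj t ht j
      _ = _ := by simp; ring
  have hψ : ∀ t, HasDerivAt (fun t => φ t * Real.exp (-(m * K ^ 2 * t ^ 2 / 2)))
      ((∑ i, G t i (S i)) * Real.exp (-(m * K ^ 2 * t ^ 2 / 2)) +
        φ t * (Real.exp (-(m * K ^ 2 * t ^ 2 / 2)) * (-(m * K ^ 2 * t)))) t := by
    intro t
    refine (hder t).mul ?_
    have h1 : HasDerivAt (fun t : ℝ => -(m * K ^ 2 * t ^ 2 / 2)) (-(m * K ^ 2 * t)) t := by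
      have := ((((hasDerivAt_id t).pow 2).const_mul ((m : ℝ) * K ^ 2)).div_const 2).neg
      refine this.congr_deriv ?_
      simp only [id, Nat.cast_ofNat]
      ring
    exact h1.exp
  have hanti : AntitoneOn (fun t => φ t * Real.exp (-(m * K ^ 2 * t ^ 2 / 2))) (Set.Ici 0) := by
    refine antitoneOn_of_deriv_nonpos (convex_Ici 0)
      (fun t _ => (hψ t).continuousAt.continuousWithinAt)
      (fun t _ => (hψ t).differentiableAt.differentiableWithinAt) ?_
    intro t ht
    rw [interior_Ici] at ht
    rw [(hψ t).deriv]
    have := hder_le t (le_of_lt ht)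
    nlinarith [Real.exp_pos (-(m * K ^ 2 * t ^ 2 / 2))]
  have hφθ : φ θ ≤ (n ^ m : ℝ) * d * Real.exp (m * K ^ 2 * θ ^ 2 / 2) := by
    have h1 := hanti (Set.mem_Ici.2 le_rfl) (Set.mem_Ici.2 hθ) hθ
    have h0 : φ 0 = (n ^ m : ℝ) * d := by simp [hφ]
    simp only [h0] at h1
    rw [Real.exp_neg, ← div_eq_mul_inv, div_le_iff₀ (Real.exp_pos _)] at h1
    simpa using h1
  refine le_trans ?_ hφθ
  classical
  rw [Nat.card_eq_fintype_card, Fintype.card_subtype, ← nsmul_eq_mul, ← Finset.sum_const]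
  refine le_trans (Finset.sum_le_sum fun i hi => ?_)
    (Finset.sum_le_sum_of_subset_of_nonneg (Finset.filter_subset _ _)
      fun i _ _ => Finset.sum_nonneg fun k _ => (Real.cosh_pos _).le)
  rw [Finset.mem_filter] at hi
  have : ∃ k, r < |a i k| := by
    by_contra! hcon
    exact hi.2 (aux_norm (S i) (u i) (a i) (hu i) r hr hcon)
  obtain ⟨k, hk⟩ := this
  refine le_trans ?_ (Finset.single_le_sum (f := fun k => Real.cosh (θ * a i k))
    (fun k _ => (Real.cosh_pos _).le) (Finset.mem_univ k))
  rw [Real.cosh_le_cosh, abs_mul, abs_mul, abs_of_nonneg hr]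
  gcongr

lemma aux_grad {d : ℕ} (g : EuclideanSpace ℝ (Fin d) → ℝ) (hg : ContDiff ℝ 2 g) :
    Differentiable ℝ (gradient g) := by
  have h1 : Differentiable ℝ (fderiv ℝ g) :=
    (hg.fderiv_right (m := 1) (by norm_num)).differentiable (by norm_num)
  intro x
  exact ((InnerProductSpace.toDual ℝ (EuclideanSpace ℝ (Fin d))).symm.toContinuousLinearEquiv
    : _ ≃L[ℝ] _).differentiableAt.comp x (h1 x)

lemma aux_symm {d : ℕ} (g : EuclideanSpace ℝ (Fin d) → ℝ) (hg : ContDiff ℝ 2 g)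
    (x : EuclideanSpace ℝ (Fin d)) :
    (fderiv ℝ (gradient g) x : EuclideanSpace ℝ (Fin d) →ₗ[ℝ] EuclideanSpace ℝ (Fin d)).IsSymmetric := by
  have h1 : Differentiable ℝ (fderiv ℝ g) :=
    (hg.fderiv_right (m := 1) (by norm_num)).differentiable (by norm_num)
  have hs : IsSymmSndFDerivAt ℝ g x := hg.contDiffAt.isSymmSndFDerivAt (by simp)
  have key : ∀ y z, inner ℝ (fderiv ℝ (gradient g) x y) z = fderiv ℝ (fderiv ℝ g) x y z := by
    intro y z
    have e : (fun w => inner ℝ (gradient g w) z) = fun w => fderiv ℝ g w z := by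
      funext w
      simp [gradient]
    have a1 : HasFDerivAt (fun w => fderiv ℝ g w z) _ x :=
      (h1 x).hasFDerivAt.clm_apply (hasFDerivAt_const z x)
    have a2 := (aux_grad g hg x).hasFDerivAt.inner ℝ (hasFDerivAt_const z x)
    rw [e] at a2
    have := congrArg (fun T => T y) (a2.unique a1)
    simpa using this
  intro y z
  simp only [ContinuousLinearMap.coe_coe]
  rw [key, real_inner_comm, key, hs.eq]

lemma aux_mean {d n : ℕ} (f : Fin n → EuclideanSpace ℝ (Fin d) → ℝ)
    (hdiff : ∀ i, ContDiff ℝ 2 (f i)) (x : EuclideanSpace ℝ (Fin d)) :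
    fderiv ℝ (gradient (fun y => (1 / n : ℝ) * ∑ j, f j y)) x =
      (1 / n : ℝ) • ∑ j, fderiv ℝ (gradient (f j)) x := by
  have e : gradient (fun y => (1 / n : ℝ) * ∑ j, f j y) =
      fun y => (1 / n : ℝ) • ∑ j, gradient (f j) y := by
    funext y
    have : HasFDerivAt (fun y => (1 / n : ℝ) * ∑ j, f j y)
        ((1 / n : ℝ) • ∑ j, fderiv ℝ (f j) y) y :=
      (HasFDerivAt.fun_sum fun j _ =>
        ((hdiff j).differentiable (by norm_num) y).hasFDerivAt).const_mul _
    simp only [gradient, this.fderiv, map_smul, map_sum]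
  rw [e]
  exact ((HasFDerivAt.fun_sum fun j _ =>
    (aux_grad (f j) (hdiff j) x).hasFDerivAt).const_smul (1 / n : ℝ)).fderiv


/-- subsampled Hessian concentration.  The Hessian of a function `φ`
at `x` is formalized as `fderiv ℝ (gradient φ) x`, and the probability over the
i.i.d. uniform choice of the indices `i : Fin m → Fin n` is expressed by counting:
`P(event) = Nat.card {i // event i} / n^m`. -/
theorem stmt_15 {d n : ℕ} (hd : 0 < d) (hn : 0 < n)
    (f : Fin n → EuclideanSpace ℝ (Fin d) → ℝ)
    (hdiff : ∀ i, ContDiff ℝ 2 (f i))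
    (x : EuclideanSpace ℝ (Fin d)) (LB : ℝ)
    (hLB : ∀ i, ‖fderiv ℝ (gradient (f i)) x‖ ≤ LB)
    (δ εB v₀ : ℝ) (hδ0 : 0 < δ) (hδ1 : δ < 1) (hεB : 0 < εB)
    (hv₀0 : 0 < v₀) (hv₀1 : v₀ ≤ 1)
    (m : ℕ)
    (hm : 16 * Real.log (2 * d / δ) * LB ^ 2 / (v₀ ^ 2 * εB ^ 2) ≤ (m : ℝ)) :
    1 - δ ≤ (Nat.card {i : Fin m → Fin n //
        ‖fderiv ℝ (gradient (fun y => (1 / n : ℝ) * ∑ j, f j y)) x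
            - (m : ℝ)⁻¹ • ∑ j, fderiv ℝ (gradient (f (i j))) x‖ ≤ v₀ * εB} : ℝ)
          / (n ^ m : ℝ) := by
  set H : Fin n → EuclideanSpace ℝ (Fin d) →L[ℝ] EuclideanSpace ℝ (Fin d) :=
    fun k => fderiv ℝ (gradient (f k)) x with hH
  rw [aux_mean f hdiff x]
  change ∀ k, ‖H k‖ ≤ LB at hLB
  change 1 - δ ≤ (Nat.card {i : Fin m → Fin n //
        ‖(1 / n : ℝ) • ∑ j, H j - (m : ℝ)⁻¹ • ∑ j, H (i j)‖ ≤ v₀ * εB} : ℝ) / (n ^ m : ℝ)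
  have hHs : ∀ k, (H k : EuclideanSpace ℝ (Fin d) →ₗ[ℝ] EuclideanSpace ℝ (Fin d)).IsSymmetric :=
    fun k => aux_symm (f k) (hdiff k) x
  have hnR : (0 : ℝ) < n := by exact_mod_cast hn
  have hdR : (1 : ℝ) ≤ d := by exact_mod_cast hd
  have ht : 0 < v₀ * εB := by positivity
  set t := v₀ * εB with htdef
  have hnm : (0 : ℝ) < (n : ℝ) ^ m := by positivity
  have hlog : 0 < Real.log (2 * d / δ) := by
    apply Real.log_pos
    rw [lt_div_iff₀ hδ0]; linarith
  rw [le_div_iff₀ hnm]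
  have hL0 : 0 ≤ LB := (norm_nonneg _).trans (hLB ⟨0, hn⟩)
  rcases hL0.eq_or_lt with hL | hL
  · have hz : ∀ k, H k = 0 := fun k => norm_le_zero_iff.1 (hL ▸ hLB k)
    have : ∀ i : Fin m → Fin n,
        ‖(1 / n : ℝ) • ∑ j, H j - (m : ℝ)⁻¹ • ∑ j, H (i j)‖ ≤ t := by
      intro i
      simp [hz, ht.le]
    rw [Nat.card_congr (Equiv.subtypeUnivEquiv this)]
    simp only [Nat.card_eq_fintype_card, Fintype.card_fun, Fintype.card_fin, Nat.cast_pow]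
    nlinarith
  have hmt : 16 * Real.log (2 * d / δ) * LB ^ 2 ≤ m * t ^ 2 := by
    rw [div_le_iff₀ (by positivity)] at hm
    rw [htdef]; linarith
  have hmR : (0 : ℝ) < m := by
    have : 0 < m * t ^ 2 := lt_of_lt_of_le (by positivity) hmt
    exact pos_of_mul_pos_left this (by positivity)
  set M := (1 / n : ℝ) • ∑ j, H j with hM
  have hMs : (M : EuclideanSpace ℝ (Fin d) →ₗ[ℝ] EuclideanSpace ℝ (Fin d)).IsSymmetric := by
    intro y z
    simp only [hM, ContinuousLinearMap.coe_coe, smul_apply,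
      sum_apply, real_inner_smul_left, real_inner_smul_right, sum_inner,
      inner_sum]
    congr 1
    exact Finset.sum_congr rfl fun j _ => hHs j y z
  have hconc := aux_conc (m := m) hn (fun k => H k - M)
    (fun k y z => by
      have h1 := hHs k y z
      have h2 := hMs y z
      simp only [ContinuousLinearMap.coe_coe, sub_apply, inner_sub_left,
        inner_sub_right] at h1 h2 ⊢
      rw [h1, h2])
    (by
      rw [Finset.sum_sub_distrib, hM]
      simp only [Finset.sum_const, Finset.card_univ, Fintype.card_fin]
      rw [← Nat.cast_smul_eq_nsmul ℝ, smul_smul, mul_one_div_cancel hnR.ne', one_smul, sub_self])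
    (2 * LB)
    (fun k l => by
      rw [sub_sub_sub_cancel_right]
      have := norm_sub_le (H k) (H l)
      linarith [hLB k, hLB l])
    (t / (4 * LB ^ 2)) (by positivity) (m * t) (by positivity)
  have hiff : ∀ i : Fin m → Fin n, ‖∑ j, (H (i j) - M)‖ ≤ m * t ↔
      ‖M - (m : ℝ)⁻¹ • ∑ j, H (i j)‖ ≤ t := by
    intro i
    have : ∑ j, (H (i j) - M) = -((m : ℝ) • (M - (m : ℝ)⁻¹ • ∑ j, H (i j))) := by
      rw [smul_sub, smul_inv_smul₀ hmR.ne', Finset.sum_sub_distrib]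
      simp only [Finset.sum_const, Finset.card_univ, Fintype.card_fin]
      rw [← Nat.cast_smul_eq_nsmul ℝ]
      abel
    rw [this, norm_neg, norm_smul, Real.norm_eq_abs, abs_of_pos hmR]
    exact mul_le_mul_iff_right₀ hmR
  simp only [hiff] at hconc
  have hcard : (Nat.card {i : Fin m → Fin n // ‖M - (m : ℝ)⁻¹ • ∑ j, H (i j)‖ ≤ t} : ℝ)
      + (Nat.card {i : Fin m → Fin n // ¬ ‖M - (m : ℝ)⁻¹ • ∑ j, H (i j)‖ ≤ t} : ℝ)
      = (n : ℝ) ^ m := by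
    classical
    have h1 := Fintype.card_subtype_compl
      (fun i : Fin m → Fin n => ‖M - (m : ℝ)⁻¹ • ∑ j, H (i j)‖ ≤ t)
    have h2 := Fintype.card_subtype_le
      (fun i : Fin m → Fin n => ‖M - (m : ℝ)⁻¹ • ∑ j, H (i j)‖ ≤ t)
    have h3 : Fintype.card (Fin m → Fin n) = n ^ m := by simp
    rw [h3] at h1 h2
    rw [Nat.card_eq_fintype_card, Nat.card_eq_fintype_card, h1]
    push_cast [h2]
    ring
  set N := (Nat.card {i : Fin m → Fin n // ¬ ‖M - (m : ℝ)⁻¹ • ∑ j, H (i j)‖ ≤ t} : ℝ) with hN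
  have hN0 : 0 ≤ N := Nat.cast_nonneg _
  suffices N ≤ δ * (n : ℝ) ^ m by linarith
  set q := m * t ^ 2 / (8 * LB ^ 2) with hq
  have e1 : t / (4 * LB ^ 2) * (m * t) = 2 * q := by rw [hq]; field_simp; norm_num
  have e2 : (m : ℝ) * (2 * LB) ^ 2 * (t / (4 * LB ^ 2)) ^ 2 / 2 = q := by
    rw [hq]; field_simp; norm_num
  rw [e1, e2] at hconc
  have hqge : Real.log (2 * d / δ) ≤ q := by
    rw [hq, le_div_iff₀ (by positivity)]
    have : 0 < Real.log (2 * d / δ) * LB ^ 2 := by positivity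
    linarith
  have hexp : 2 * d / δ ≤ Real.exp q := by
    rw [← Real.log_le_iff_le_exp (by positivity)]; exact hqge
  have hcosh : Real.exp q * Real.exp q / 2 ≤ Real.cosh (2 * q) := by
    rw [Real.cosh_eq, two_mul, Real.exp_add]
    linarith [Real.exp_pos (-(q + q))]
  have h5 : N * (Real.exp q * Real.exp q / 2) ≤ (n : ℝ) ^ m * d * Real.exp q :=
    (mul_le_mul_of_nonneg_left hcosh hN0).trans hconc
  have h6 : N * Real.exp q ≤ (n : ℝ) ^ m * d * 2 := by
    refine le_of_mul_le_mul_right ?_ (Real.exp_pos q)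
    linarith
  have h7 : N * (2 * d / δ) ≤ (n : ℝ) ^ m * d * 2 :=
    (mul_le_mul_of_nonneg_left hexp hN0).trans h6
  rw [← mul_div_assoc, div_le_iff₀ hδ0] at h7
  refine le_of_mul_le_mul_right ?_ (show (0 : ℝ) < 2 * d by positivity)
  linarith
end
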